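/- Let m', m'' ≥ 1, m = m' + m'', M' = 2^{m'}, M'' = 2^{m''}, M = M'·M'' = 2^m, and let X_QAM = X'_PAM ⊗ X''_PAM be the rectangular (M'×M'')-QAM input alphabet (the ordered direct product of the M'-PAM and M''-PAM alphabets). A constellation [X_QAM, L, U_M] is first-order optimal if and only if there exist a permutation σ of {0,…,m−1} and signs ε_0,…,ε_{m−1} ∈ {−1,+1} such that q_{i,k} = ε_k·(−1)^{b_{σ(k)}(i)} for all i, k; that is, if and only if L can be derived from the natural binary code N_m by inverting the bits in certain positions and/or permuting the sequence of bits in all codewords. -/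

import Mathlib

/-- Modified labeling matrix: `q_{i,k} = -1` if `c_{i,m-1-k} = 1`, `+1` otherwise. -/
def Qmat (m : ℕ) (c : ℕ → ℕ → Bool) (i k : ℕ) : ℝ :=
  if c i (m - 1 - k) then -1 else 1

/-- The `M`-PAM input alphabet: `x_i = 2i + 1 - M`. -/
noncomputable def xpam (m i : ℕ) : ℝ := 2 * (i : ℝ) + 1 - 2^m

/-- The rectangular `(M'×M'')`-QAM input alphabet `X'_PAM ⊗ X''_PAM`:
row `M''·l + j` is `[x'_l, x''_j] ∈ ℝ²`. -/
noncomputable def xqam (m' m'' i : ℕ) : EuclideanSpace ℝ (Fin 2) :=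
  (WithLp.equiv 2 (Fin 2 → ℝ)).symm ![xpam m' (i / 2^m''), xpam m'' (i % 2^m'')]

open Finset in
/-- subset-sum bijection onto `[0,2^m)` forces powers of two -/
lemma pow_exists (m : ℕ) (w : Fin m → ℕ)
    (hinj : ∀ S T : Finset (Fin m), ∑ k ∈ S, w k = ∑ k ∈ T, w k → S = T)
    (hsur : ∀ n < 2^m, ∃ S : Finset (Fin m), ∑ k ∈ S, w k = n) :
    ∀ j ≤ m, (∀ i < j, ∃ k, w k = 2^i) ∧ ∃ S : Finset (Fin m), ∑ k ∈ S, w k + 1 = 2^j ∧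
      ∀ n < 2^j, ∃ U ⊆ S, ∑ k ∈ U, w k = n := by
  intro j
  induction j with
  | zero =>
    intro _
    refine ⟨by simp, ∅, by simp, ?_⟩
    intro n hn
    exact ⟨∅, by simp, by simp at hn ⊢; omega⟩
  | succ j ih =>
    intro hj
    obtain ⟨h1, S, hS, hU⟩ := ih (by omega)
    obtain ⟨T, hT⟩ := hsur (2^j) (Nat.pow_lt_pow_right (by norm_num) (by omega))
    have hns : ¬ T ⊆ S := by
      intro h
      have := Finset.sum_le_sum_of_subset (f := w) h
      omega
    obtain ⟨k, hkT, hkS⟩ := Finset.not_subset.mp hns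
    have hle : w k ≤ 2^j := by
      rw [← hT]
      exact Finset.single_le_sum (fun _ _ => Nat.zero_le _) hkT
    have hk : w k = 2^j := by
      by_contra hne
      obtain ⟨U, hUS, hUs⟩ := hU (w k) (by omega)
      have : U = {k} := hinj _ _ (by simpa using hUs)
      subst this
      exact hkS (hUS (by simp))
    refine ⟨?_, insert k S, ?_, ?_⟩
    · intro i hi
      rcases Nat.lt_succ_iff_lt_or_eq.mp hi with h | h
      · exact h1 i h
      · exact ⟨k, by rw [h, hk]⟩
    · rw [Finset.sum_insert hkS, hk, pow_succ]; omega
    · intro n hn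
      by_cases h : n < 2^j
      · obtain ⟨U, hUS, h⟩ := hU n h
        exact ⟨U, hUS.trans (Finset.subset_insert _ _), h⟩
      · obtain ⟨U, hUS, h'⟩ := hU (n - 2^j) (by rw [pow_succ] at hn; omega)
        refine ⟨insert k U, Finset.insert_subset_insert _ hUS, ?_⟩
        rw [Finset.sum_insert (fun h => hkS (hUS h)), h', hk]; omega

lemma mod_succ_bit (x k : ℕ) : x % 2^(k+1) = x % 2^k + 2^k * (x.testBit k).toNat := by
  rw [Nat.mod_pow_succ, Nat.toNat_testBit]

lemma sum_bits (i m : ℕ) :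
    ∑ j ∈ Finset.range m, (if Nat.testBit i j then 2^j else 0) = i % 2^m := by
  induction m with
  | zero => simp [Nat.mod_one]
  | succ m ih =>
    rw [Finset.sum_range_succ, ih, mod_succ_bit]
    cases Nat.testBit i m <;> simp

/-- sign of a bit -/
def sg (b : Bool) : ℝ := if b then -1 else 1

lemma xpam_bits (i m : ℕ) :
    xpam m (i % 2^m) = ∑ j ∈ Finset.range m, (-2^j) * sg (Nat.testBit i j) := by
  unfold xpam
  induction m with
  | zero => simp [Nat.mod_one]
  | succ m ih =>
    rw [Finset.sum_range_succ, ← ih, mod_succ_bit]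
    cases Nat.testBit i m <;> simp [sg] <;> ring

lemma perm_core (m : ℕ) (w : Fin m → ℕ) (t : Fin (2^m) → Fin m → Bool)
    (ht : Function.Bijective t)
    (hw : ∀ i : Fin (2^m), (i : ℕ) = ∑ k, if t i k then w k else 0) :
    ∃ σ : Equiv.Perm (Fin m), ∀ i k, t i k = Nat.testBit i (σ k) := by
  classical
  have hS : ∀ S : Finset (Fin m), ∃ i : Fin (2^m), (i : ℕ) = ∑ k ∈ S, w k ∧ ∀ k, t i k = decide (k ∈ S) := by
    intro S
    obtain ⟨i, hi⟩ := ht.2 (fun k => decide (k ∈ S))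
    refine ⟨i, ?_, fun k => by rw [hi]⟩
    rw [hw i, hi]; simp [← Finset.sum_filter]
  have hinj : ∀ S T : Finset (Fin m), ∑ k ∈ S, w k = ∑ k ∈ T, w k → S = T := by
    intro S T h
    obtain ⟨i, hi, hi'⟩ := hS S
    obtain ⟨j, hj, hj'⟩ := hS T
    have : i = j := Fin.ext (by omega)
    subst this
    ext k
    have := (hi' k).symm.trans (hj' k)
    simpa using this
  have hsum : ∀ i : Fin (2^m), ∑ k ∈ Finset.univ.filter (fun k => t i k = true), w k = i := by
    intro i
    rw [hw i, Finset.sum_filter]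
  have hpow := (pow_exists m w hinj (fun n hn => ⟨_, hsum ⟨n, hn⟩⟩) m le_rfl).1
  choose κ hκ using fun j : Fin m => hpow j j.2
  have hκi : Function.Injective κ := by
    intro a b h
    have h2 : 2^(a:ℕ) = 2^(b:ℕ) := by rw [← hκ, ← hκ, h]
    exact Fin.ext (Nat.pow_right_injective le_rfl h2)
  let e : Equiv.Perm (Fin m) := Equiv.ofBijective κ (Finite.injective_iff_bijective.mp hκi)
  have he : ∀ j, e j = κ j := fun j => rfl
  refine ⟨e.symm, fun i k => ?_⟩
  have h1 : ∑ k ∈ Finset.univ.filter (fun k => Nat.testBit i (e.symm k) = true), w k = i := by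
    rw [Finset.sum_filter, ← Equiv.sum_comp e]
    simp only [Equiv.symm_apply_apply]
    simp only [he, hκ]
    have := sum_bits i m
    rw [Nat.mod_eq_of_lt i.2, Finset.sum_range] at this
    exact this
  have h2 := hinj _ _ ((hsum i).trans h1.symm)
  have h3 := congrArg (fun S => k ∈ S) h2
  simp at h3
  exact h3

lemma core (m : ℕ) (e : Fin (2^m) → Fin m → Bool) (he : Function.Bijective e)
    (d : Fin m → ℝ) (hd : ∀ i : Fin (2^m), xpam m i = ∑ k, d k * sg (e i k)) :
    ∃ σ : Equiv.Perm (Fin m), ∃ ε : Fin m → ℝ, (∀ k, ε k = 1 ∨ ε k = -1) ∧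
      ∀ i k, sg (e i k) = ε k * sg (Nat.testBit i (σ k)) := by
  classical
  let p : Fin m → Bool := fun k => decide (0 < d k)
  let t : Fin (2^m) → Fin m → Bool := fun i k => xor (e i k) (p k)
  have ht : Function.Bijective t := by
    constructor
    · intro i j h
      apply he.1
      ext k
      have := congrFun h k
      simpa [t] using this
    · intro s
      obtain ⟨i, hi⟩ := he.2 (fun k => xor (s k) (p k))
      exact ⟨i, by ext k; simp [t, hi]⟩
  have h0 : ∀ i k, d k * sg (e i k) = 2 * (if t i k then |d k| else 0) - |d k| := by
    intro i k
    by_cases h : 0 < d k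
    · have : t i k = !(e i k) := by simp [t, p, h]
      rw [this, abs_of_pos h]
      cases e i k <;> simp [sg] <;> ring
    · have : t i k = e i k := by simp [t, p, h]
      rw [this, abs_of_nonpos (not_lt.mp h)]
      cases e i k <;> simp [sg] <;> ring
  obtain ⟨C, hC⟩ : ∃ C : ℝ, ∀ i : Fin (2^m), (i : ℝ) = C + ∑ k, if t i k then |d k| else 0 := by
    refine ⟨(2^m - 1 - ∑ k, |d k|)/2, fun i => ?_⟩
    have := hd i
    simp only [h0, Finset.sum_sub_distrib, ← Finset.mul_sum, xpam] at this
    linarith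
  have hC0 : C = 0 := by
    apply le_antisymm
    · have := hC ⟨0, by positivity⟩
      have h2 : 0 ≤ ∑ k, if t ⟨0, by positivity⟩ k then |d k| else 0 :=
        Finset.sum_nonneg (fun k _ => by split_ifs <;> positivity)
      simp only [Nat.cast_zero] at this
      linarith
    · obtain ⟨i, hi⟩ := ht.2 (fun _ => false)
      have := hC i
      rw [hi] at this
      simp at this
      rw [← this]; positivity
  have hwk : ∀ k, ∃ n : ℕ, (n : ℝ) = |d k| := by
    intro k
    obtain ⟨i, hi⟩ := ht.2 (fun l => decide (l = k))
    refine ⟨i, ?_⟩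
    rw [hC i, hi, hC0]; simp
  choose w hw using hwk
  obtain ⟨σ, hσ⟩ := perm_core m w t ht (by
    intro i
    have := hC i
    rw [hC0, zero_add] at this
    simp only [← hw] at this
    exact_mod_cast this)
  refine ⟨σ, fun k => sg (p k), fun k => by rcases Bool.eq_false_or_eq_true (p k) with h | h <;> simp [sg, h], fun i k => ?_⟩
  rw [← hσ]
  simp only [t]
  generalize p k = b
  cases e i k <;> cases b <;> simp [sg]

lemma orth (m : ℕ) (e : Fin (2^m) → Fin m → Bool) (he : Function.Bijective e) (k l : Fin m) :
    ∑ i, sg (e i k) * sg (e i l) = if k = l then (2:ℝ)^m else 0 := by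
  classical
  have h1 : ∑ i, sg (e i k) * sg (e i l) = ∑ s : Fin m → Bool, sg (s k) * sg (s l) :=
    Equiv.sum_comp (Equiv.ofBijective e he) (fun s => sg (s k) * sg (s l))
  split_ifs with h
  · subst h
    have : ∀ i, sg (e i k) * sg (e i k) = 1 := fun i => by cases e i k <;> simp [sg]
    simp [this]
  · rw [h1]
    have hinv : Function.Involutive (fun s : Fin m → Bool => fun j => xor (s j) (decide (j = k))) := by
      intro s; ext j; simp
    have h2 := Equiv.sum_comp (Function.Involutive.toPerm _ hinv) (fun s : Fin m → Bool => sg (s k) * sg (s l))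
    have h3 : ∀ s : Fin m → Bool, sg (Function.Involutive.toPerm _ hinv s k) * sg (Function.Involutive.toPerm _ hinv s l)
        = - (sg (s k) * sg (s l)) := by
      intro s
      have hl : ¬ l = k := fun h' => h h'.symm
      simp only [Function.Involutive.coe_toPerm, hl]
      cases s k <;> cases s l <;> simp [sg]
    simp only [h3, Finset.sum_neg_distrib] at h2
    linarith

section bessel
variable {ι κ : Type} [Fintype ι] [Fintype κ] [DecidableEq κ]

lemma inner_comb (q : ι → κ → ℝ) (N : ℝ)
    (ho : ∀ k l, ∑ i, q i k * q i l = if k = l then N else 0) (d : κ → ℝ) (k : κ) :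
    ∑ i, q i k * ∑ l, d l * q i l = N * d k := by
  simp only [Finset.mul_sum]
  rw [Finset.sum_comm]
  have : ∀ l, ∑ i, q i k * (d l * q i l) = d l * (if k = l then N else 0) := by
    intro l; rw [← ho, Finset.mul_sum]; exact Finset.sum_congr rfl (fun _ _ => by ring)
  simp only [this]
  simp [mul_comm]

lemma sq_comb (q : ι → κ → ℝ) (N : ℝ)
    (ho : ∀ k l, ∑ i, q i k * q i l = if k = l then N else 0) (d : κ → ℝ) :
    ∑ i, (∑ l, d l * q i l)^2 = N * ∑ k, d k ^2 := by
  have : ∀ i, (∑ l, d l * q i l)^2 = ∑ k, d k * (q i k * ∑ l, d l * q i l) := by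
    intro i
    rw [sq]
    nth_rw 1 [Finset.sum_mul]
    exact Finset.sum_congr rfl (fun _ _ => by ring)
  simp only [this]
  rw [Finset.sum_comm, Finset.mul_sum]
  refine Finset.sum_congr rfl (fun k _ => ?_)
  rw [← Finset.mul_sum, inner_comb q N ho]; ring

lemma resid (q : ι → κ → ℝ) (N : ℝ) (hN : N ≠ 0)
    (ho : ∀ k l, ∑ i, q i k * q i l = if k = l then N else 0) (f : ι → ℝ) :
    ∑ i, (f i - ∑ k, (N⁻¹ * ∑ j, q j k * f j) * q i k)^2
      = ∑ i, f i ^2 - N * ∑ k, (N⁻¹ * ∑ j, q j k * f j)^2 := by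
  set a : κ → ℝ := fun k => N⁻¹ * ∑ j, q j k * f j with ha
  have h1 : ∑ i, f i * ∑ k, a k * q i k = N * ∑ k, a k ^2 := by
    simp only [Finset.mul_sum]
    rw [Finset.sum_comm]
    refine Finset.sum_congr rfl (fun k _ => ?_)
    have : ∑ j, q j k * f j = N * a k := by simp only [ha]; field_simp
    calc ∑ i, f i * (a k * q i k) = a k * ∑ j, q j k * f j := by
          rw [Finset.mul_sum]; exact Finset.sum_congr rfl (fun _ _ => by ring)
      _ = _ := by rw [this]; ring
  have h2 := sq_comb q N ho a
  change ∑ i, (f i - ∑ k, a k * q i k)^2 = ∑ i, f i ^2 - N * ∑ k, a k ^2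
  calc _ = ∑ i, f i ^2 - 2 * ∑ i, f i * ∑ k, a k * q i k + ∑ i, (∑ k, a k * q i k)^2 := by
        rw [Finset.mul_sum, ← Finset.sum_sub_distrib, ← Finset.sum_add_distrib]
        exact Finset.sum_congr rfl (fun _ _ => by ring)
    _ = _ := by rw [h1, h2]; ring

lemma parseval_of_comb (q : ι → κ → ℝ) (N : ℝ) (hN : N ≠ 0)
    (ho : ∀ k l, ∑ i, q i k * q i l = if k = l then N else 0) (f : ι → ℝ) (d : κ → ℝ)
    (hf : ∀ i, f i = ∑ k, d k * q i k) :
    ∑ i, f i ^2 = N * ∑ k, (N⁻¹ * ∑ j, q j k * f j)^2 := by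
  have h : ∀ k, N⁻¹ * ∑ j, q j k * f j = d k := by
    intro k
    simp only [hf]
    rw [inner_comb q N ho]; field_simp
  simp only [h]
  simp only [hf]
  exact sq_comb q N ho d

lemma comb_of_parseval (q : ι → κ → ℝ) (N : ℝ) (hN : 0 < N)
    (ho : ∀ k l, ∑ i, q i k * q i l = if k = l then N else 0) (f g : ι → ℝ)
    (h : ∑ i, (f i ^2 + g i ^2) = N * ∑ k, ((N⁻¹ * ∑ j, q j k * f j)^2 +
      (N⁻¹ * ∑ j, q j k * g j)^2)) :
    (∀ i, f i = ∑ k, (N⁻¹ * ∑ j, q j k * f j) * q i k) ∧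
    (∀ i, g i = ∑ k, (N⁻¹ * ∑ j, q j k * g j) * q i k) := by
  have hf := resid q N hN.ne' ho f
  have hg := resid q N hN.ne' ho g
  rw [Finset.sum_add_distrib, Finset.sum_add_distrib] at h
  have pf : 0 ≤ ∑ i, (f i - ∑ k, (N⁻¹ * ∑ j, q j k * f j) * q i k)^2 :=
    Finset.sum_nonneg (fun _ _ => sq_nonneg _)
  have pg : 0 ≤ ∑ i, (g i - ∑ k, (N⁻¹ * ∑ j, q j k * g j) * q i k)^2 :=
    Finset.sum_nonneg (fun _ _ => sq_nonneg _)
  have zf : ∑ i, (f i - ∑ k, (N⁻¹ * ∑ j, q j k * f j) * q i k)^2 = 0 := by linarith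
  have zg : ∑ i, (g i - ∑ k, (N⁻¹ * ∑ j, q j k * g j) * q i k)^2 = 0 := by linarith
  rw [Finset.sum_eq_zero_iff_of_nonneg (fun _ _ => sq_nonneg _)] at zf zg
  exact ⟨fun i => by have := pow_eq_zero_iff (two_ne_zero) |>.mp (zf i (Finset.mem_univ _)); linarith,
    fun i => by have := pow_eq_zero_iff (two_ne_zero) |>.mp (zg i (Finset.mem_univ _)); linarith⟩

end bessel

lemma comb_perm (m : ℕ) (σ : Equiv.Perm (Fin m)) (ε : Fin m → ℝ) (hε : ∀ k, ε k = 1 ∨ ε k = -1)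
    (q : Fin m → ℝ) (r g : ℕ → ℝ) (hq : ∀ k, q k = ε k * r (σ k)) :
    ∑ j ∈ Finset.range m, g j * r j = ∑ k, (ε k * g (σ k)) * q k := by
  rw [Finset.sum_range, ← Equiv.sum_comp σ]
  refine Finset.sum_congr rfl (fun k _ => ?_)
  rw [hq]
  rcases hε k with h | h <;> rw [h] <;> ring

/-- `[X_QAM, L, U_M]` is first-order optimal iff there are a permutation `σ` of
`{0,…,m-1}` and signs `ε_k ∈ {±1}` with `q_{i,k} = ε_k·(-1)^{b_{σ(k)}(i)}`,
i.e., iff `L` is the NBC up to bit inversions and bit-position permutations. -/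
theorem qam_foo_iff_nbc (m' m'' : ℕ) (hm' : 1 ≤ m') (hm'' : 1 ≤ m'')
    (c : ℕ → ℕ → Bool)
    (hc : ∀ i < 2^(m'+m''), ∀ j < 2^(m'+m''),
      (∀ k < m'+m'', c i k = c j k) → i = j) :
    (Real.logb 2 (Real.exp 1) /
        ((2^(m'+m'') : ℝ)⁻¹ *
          ∑ i ∈ Finset.range (2^(m'+m'')), ‖xqam m' m'' i‖^2)) *
      ∑ k ∈ Finset.range (m'+m''),
        ‖(2^(m'+m'') : ℝ)⁻¹ •
          ∑ i ∈ Finset.range (2^(m'+m'')), Qmat (m'+m'') c i k • xqam m' m'' i‖^2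
      = Real.logb 2 (Real.exp 1)
    ↔ ∃ σ : Equiv.Perm (Fin (m'+m'')), ∃ ε : Fin (m'+m'') → ℝ,
        (∀ k, ε k = 1 ∨ ε k = -1) ∧
        ∀ i < 2^(m'+m''), ∀ k : Fin (m'+m''),
          Qmat (m'+m'') c i (k : ℕ)
            = ε k * (if Nat.testBit i ((σ k : Fin (m'+m'')) : ℕ) then (-1:ℝ) else 1) := by
  set m := m' + m'' with hm
  let e : Fin (2^m) → Fin m → Bool := fun i k => c i (m - 1 - k)
  have hei : Function.Injective e := by
    intro i j h
    refine Fin.ext (hc i i.2 j j.2 (fun k hk => ?_))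
    have := congrFun h ⟨m - 1 - k, by omega⟩
    simp only [e] at this
    rwa [show m - 1 - (m - 1 - k) = k by omega] at this
  have he : Function.Bijective e :=
    (Fintype.bijective_iff_injective_and_card e).mpr ⟨hei, by simp⟩
  have hQ : ∀ (i : Fin (2^m)) (k : Fin m), Qmat m c i k = sg (e i k) := fun i k => rfl
  have ho := orth m e he
  have hN : (0:ℝ) < 2^m := by positivity
  let u : Fin (2^m) → ℝ := fun i => xpam m' (i / 2^m'')
  let v : Fin (2^m) → ℝ := fun i => xpam m'' (i % 2^m'')
  have hE : ∑ i ∈ Finset.range (2^m), ‖xqam m' m'' i‖^2 = ∑ i, (u i ^2 + v i ^2) := by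
    rw [Finset.sum_range]
    refine Finset.sum_congr rfl (fun i _ => ?_)
    rw [EuclideanSpace.real_norm_sq_eq]
    simp [xqam, u, v]
  have hA : ∑ k ∈ Finset.range m, ‖(2^m : ℝ)⁻¹ •
          ∑ i ∈ Finset.range (2^m), Qmat m c i k • xqam m' m'' i‖^2
      = ∑ k : Fin m, (((2^m : ℝ)⁻¹ * ∑ j, sg (e j k) * u j)^2 +
          ((2^m : ℝ)⁻¹ * ∑ j, sg (e j k) * v j)^2) := by
    rw [Finset.sum_range]
    refine Finset.sum_congr rfl (fun k _ => ?_)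
    rw [EuclideanSpace.real_norm_sq_eq, Finset.sum_range]
    simp [xqam, u, v, hQ]
  have hpos : 0 < ∑ i, (u i ^2 + v i ^2) := by
    apply Finset.sum_pos' (fun i _ => by positivity)
    refine ⟨⟨0, by positivity⟩, Finset.mem_univ _, ?_⟩
    have : (2:ℝ) ≤ 2^m' := by
      calc (2:ℝ) = 2^1 := by norm_num
        _ ≤ 2^m' := pow_le_pow_right₀ (by norm_num) hm'
    have h2 : u ⟨0, by positivity⟩ < 0 := by
      simp only [u, xpam, Nat.zero_div, Nat.cast_zero]; linarith
    have := mul_pos_of_neg_of_neg h2 h2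
    nlinarith [sq_nonneg (v ⟨0, by positivity⟩)]
  have hlog : Real.logb 2 (Real.exp 1) ≠ 0 :=
    (Real.logb_pos (by norm_num) (Real.one_lt_exp_iff.mpr one_pos)).ne'
  have huw : ∀ i : Fin (2^m), xpam m i = 2^m'' * u i + v i := by
    intro i
    have h : ((2:ℝ)^m'' * ((i / 2^m'' : ℕ) : ℝ) + ((i % 2^m'' : ℕ) : ℝ)) = (i : ℕ) := by
      exact_mod_cast Nat.div_add_mod (i:ℕ) (2^m'')
    simp only [u, v, xpam]
    have h5 : (2:ℝ)^m = 2^m' * 2^m'' := by rw [hm, pow_add]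
    rw [← h, h5]; ring
  rw [hE, hA]
  have hiff : ∀ L E A : ℝ, L ≠ 0 → 0 < E → (L / (((2:ℝ)^m)⁻¹ * E) * A = L ↔ E = 2^m * A) := by
    intro L E A hL hE
    constructor
    · intro h
      field_simp at h
      linarith
    · intro h
      have hA : A ≠ 0 := by rintro rfl; simp at h; exact hE.ne' h
      rw [h]; field_simp
  rw [hiff _ _ _ hlog hpos]
  constructor
  · intro h
    obtain ⟨h1, h2⟩ := comb_of_parseval (fun i k => sg (e i k)) (2^m) hN ho u v h
    obtain ⟨σ, ε, hε, hσ⟩ := core m e he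
      (fun k => 2^m'' * ((2^m : ℝ)⁻¹ * ∑ j, sg (e j k) * u j) +
        ((2^m : ℝ)⁻¹ * ∑ j, sg (e j k) * v j)) (by
        intro i
        rw [huw]
        simp only [add_mul, Finset.sum_add_distrib]
        rw [← h2 i]
        simp only [mul_assoc (2^m'' : ℝ)]
        rw [← Finset.mul_sum, ← h1 i])
    exact ⟨σ, ε, hε, fun i hi k => hσ ⟨i, hi⟩ k⟩
  · rintro ⟨σ, ε, hε, hσ⟩
    have hsplit : ∀ F : ℕ → ℝ, ∑ j ∈ Finset.range m, F j
        = ∑ j ∈ Finset.range m'', F j + ∑ j ∈ Finset.range m', F (m'' + j) := by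
      intro F
      rw [hm, add_comm m' m'', Finset.sum_range_add]
    have hu : ∀ i : Fin (2^m), u i = ∑ j ∈ Finset.range m,
        (if j < m'' then 0 else -2^(j - m'')) * sg (Nat.testBit i j) := by
      intro i
      have hlt : (i : ℕ) / 2^m'' < 2^m' := by
        apply Nat.div_lt_of_lt_mul
        rw [← pow_add, add_comm]; exact i.2
      have := xpam_bits ((i:ℕ) / 2^m'') m'
      rw [Nat.mod_eq_of_lt hlt] at this
      simp only [u]
      rw [this, hsplit]
      symm
      rw [add_eq_right.mpr]
      · refine Finset.sum_congr rfl (fun j _ => ?_)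
        rw [Nat.testBit_div_two_pow, add_comm j m'']
        simp
      · exact Finset.sum_eq_zero (fun j hj => by simp [Finset.mem_range.mp hj])
    have hv : ∀ i : Fin (2^m), v i = ∑ j ∈ Finset.range m,
        (if j < m'' then -2^j else 0) * sg (Nat.testBit i j) := by
      intro i
      simp only [v]
      rw [xpam_bits, hsplit]
      symm
      rw [add_eq_left.mpr]
      · refine Finset.sum_congr rfl (fun j hj => ?_)
        simp [Finset.mem_range.mp hj]
      · exact Finset.sum_eq_zero (fun j _ => by simp)
    have hq : ∀ (i : Fin (2^m)) (k : Fin m), sg (e i k) = ε k * sg (Nat.testBit i (σ k)) :=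
      fun i k => hσ i i.2 k
    rw [Finset.sum_add_distrib, Finset.sum_add_distrib, mul_add]
    congr 1
    · exact parseval_of_comb (fun i k => sg (e i k)) (2^m) hN.ne' ho u _ (fun i =>
        (hu i).trans (comb_perm m σ ε hε (fun k => sg (e i k)) (fun j => sg (Nat.testBit i j)) _
          (hq i)))
    · exact parseval_of_comb (fun i k => sg (e i k)) (2^m) hN.ne' ho v _ (fun i =>
        (hv i).trans (comb_perm m σ ε hε (fun k => sg (e i k)) (fun j => sg (Nat.testBit i j)) _
          (hq i)))
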